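/- Let X be a complete CAT(0) space, p ∈ X, and (X_i) a nested non-increasing sequence of non-empty closed convex subsets with empty intersection; let x_i = π_{X_i}(p) be the projections. Then d(p, x_i) → ∞, and for all j ≥ i the comparison angle ∠̄_{x_i}(p, x_j) ≥ π/2, hence ∠̄_p(x_i, x_j) ≤ π/2 and, for points x_i(t), x_j(t) at distance t from p on the segments [p,x_i], [p,x_j], one has d(x_i(t), x_j(t)) ≤ √2 · t. -/

import Mathlib

/-- A (complete) CAT(0) structure on a metric space, given by a choice of
geodesics together with the Bruhat–Tits (CN) comparison inequality. -/
structure GeodCat (X : Type*) [MetricSpace X] where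
  geod : X → X → ℝ → X
  geod_zero : ∀ x y, geod x y 0 = x
  geod_one : ∀ x y, geod x y 1 = y
  geod_dist : ∀ x y, ∀ s ∈ Set.Icc (0 : ℝ) 1, ∀ t ∈ Set.Icc (0 : ℝ) 1,
    dist (geod x y s) (geod x y t) = |s - t| * dist x y
  bruhat_tits : ∀ p x y, dist p (geod x y (1 / 2)) ^ 2 ≤
    (dist p x ^ 2 + dist p y ^ 2) / 2 - dist x y ^ 2 / 4

/-- The comparison angle at `x` between `y` and `z`: the angle at the vertex
corresponding to `x` in a Euclidean comparison triangle. -/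
noncomputable def compAngle {X : Type*} [MetricSpace X] (x y z : X) : ℝ :=
  Real.arccos ((dist x y ^ 2 + dist x z ^ 2 - dist y z ^ 2) /
    (2 * dist x y * dist x z))

/-- The Alexandrov angle at `x` between `y` and `z`, obtained as the infimum
(= monotone limit) of comparison angles of points approaching `x` along the
geodesics `[x,y]` and `[x,z]`. -/
noncomputable def alexAngle {X : Type*} [MetricSpace X] (g : GeodCat X)
    (x y z : X) : ℝ :=
  sInf {θ : ℝ | ∃ s ∈ Set.Ioc (0 : ℝ) 1, ∃ t ∈ Set.Ioc (0 : ℝ) 1,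
    θ = compAngle x (g.geod x y s) (g.geod x z t)}

open Filter Topology in
theorem nonpos_of_forall_le_mul_half_pow {y C : ℝ} (h : ∀ n : ℕ, y ≤ C * (1 / 2) ^ n) : y ≤ 0 := by
  have ht : Tendsto (fun n : ℕ => C * (1 / 2 : ℝ) ^ n) atTop (𝓝 (C * 0)) :=
    (tendsto_pow_atTop_nhds_zero_of_lt_one (by norm_num) (by norm_num)).const_mul C
  rw [mul_zero] at ht
  exact ge_of_tendsto' ht h

theorem nonpos_of_midpoint_convex {f : ℝ → ℝ} {C : ℝ} (h0 : f 0 ≤ 0) (h1 : f 1 ≤ 0)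
    (hC : ∀ s ∈ Set.Icc (0 : ℝ) 1, f s ≤ C)
    (hmid : ∀ s ∈ Set.Icc (0 : ℝ) 1, ∀ t ∈ Set.Icc (0 : ℝ) 1, f ((s + t) / 2) ≤ (f s + f t) / 2)
    {s : ℝ} (hs : s ∈ Set.Icc (0 : ℝ) 1) : f s ≤ 0 := by
  have key : ∀ n : ℕ, ∀ s ∈ Set.Icc (0 : ℝ) 1, f s ≤ C * (1 / 2) ^ n := by
    intro n
    induction n with
    | zero => simpa using hC
    | succ n ih =>
      rintro s ⟨hs0, hs1⟩
      rw [pow_succ]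
      rcases le_total s (1 / 2) with h | h
      · have hmem : 2 * s ∈ Set.Icc (0 : ℝ) 1 := ⟨by linarith, by linarith⟩
        have hm := hmid 0 (by simp) (2 * s) hmem
        rw [show (0 + 2 * s) / 2 = s by ring] at hm
        linarith [ih _ hmem]
      · have hmem : 2 * s - 1 ∈ Set.Icc (0 : ℝ) 1 := ⟨by linarith, by linarith⟩
        have hm := hmid (2 * s - 1) hmem 1 (by simp)
        rw [show (2 * s - 1 + 1) / 2 = s by ring] at hm
        linarith [ih _ hmem]
  exact nonpos_of_forall_le_mul_half_pow fun n => key n s hs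

namespace GeodCat

variable {X : Type*} [MetricSpace X] (g : GeodCat X)

theorem dist_left_geod (x y : X) {t : ℝ} (ht : t ∈ Set.Icc (0 : ℝ) 1) :
    dist x (g.geod x y t) = t * dist x y := by
  have h := g.geod_dist x y 0 (by simp) t ht
  rwa [g.geod_zero, zero_sub, abs_neg, abs_of_nonneg ht.1] at h

theorem eq_midpoint {x y m : X} (hx : dist m x = dist x y / 2) (hy : dist m y = dist x y / 2) :
    m = g.geod x y (1 / 2) := by
  have h := g.bruhat_tits m x y
  rw [hx, hy] at h
  have h0 : dist m (g.geod x y (1 / 2)) ^ 2 = 0 :=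
    le_antisymm (by linarith) (sq_nonneg _)
  exact dist_eq_zero.1 (pow_eq_zero_iff two_ne_zero |>.1 h0)

theorem midpoint_geod (x y : X) {s t : ℝ} (hs : s ∈ Set.Icc (0 : ℝ) 1)
    (ht : t ∈ Set.Icc (0 : ℝ) 1) :
    g.geod (g.geod x y s) (g.geod x y t) (1 / 2) = g.geod x y ((s + t) / 2) := by
  have hm : (s + t) / 2 ∈ Set.Icc (0 : ℝ) 1 :=
    ⟨by linarith [hs.1, ht.1], by linarith [hs.2, ht.2]⟩
  symm
  apply g.eq_midpoint
  · rw [g.geod_dist x y _ hm s hs, g.geod_dist x y s hs t ht,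
      show (s + t) / 2 - s = -((s - t) / 2) by ring, abs_neg, abs_div, abs_two]
    ring
  · rw [g.geod_dist x y _ hm t ht, g.geod_dist x y s hs t ht,
      show (s + t) / 2 - t = (s - t) / 2 by ring, abs_div, abs_two]
    ring

theorem dist_geod_sq_le (q x y : X) {s : ℝ} (hs : s ∈ Set.Icc (0 : ℝ) 1) :
    dist q (g.geod x y s) ^ 2 ≤
      (1 - s) * dist q x ^ 2 + s * dist q y ^ 2 - s * (1 - s) * dist x y ^ 2 := by
  let f : ℝ → ℝ := fun s => dist q (g.geod x y s) ^ 2 -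
    ((1 - s) * dist q x ^ 2 + s * dist q y ^ 2 - s * (1 - s) * dist x y ^ 2)
  refine sub_nonpos.1 (nonpos_of_midpoint_convex (f := f)
    (C := (dist q x + dist x y) ^ 2 + dist x y ^ 2) ?_ ?_ ?_ ?_ hs)
  · simp [f, g.geod_zero]
  · simp [f, g.geod_one]
  · intro s hs
    have h1 : dist q (g.geod x y s) ≤ dist q x + dist x y := by
      have := dist_triangle q x (g.geod x y s)
      rw [g.dist_left_geod x y hs] at this
      nlinarith [hs.2, dist_nonneg (x := x) (y := y)]
    have h2 := pow_le_pow_left₀ dist_nonneg h1 2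
    have h3 : 0 ≤ (1 - s) * dist q x ^ 2 := mul_nonneg (by linarith [hs.2]) (sq_nonneg _)
    have h4 : 0 ≤ s * dist q y ^ 2 := mul_nonneg hs.1 (sq_nonneg _)
    have h5 : s * (1 - s) * dist x y ^ 2 ≤ 1 * dist x y ^ 2 :=
      mul_le_mul_of_nonneg_right (by nlinarith [hs.1, hs.2]) (sq_nonneg _)
    simp only [f]
    linarith
  · intro s hs t ht
    have h := g.bruhat_tits q (g.geod x y s) (g.geod x y t)
    rw [g.midpoint_geod x y hs ht, g.geod_dist x y s hs t ht, mul_pow, sq_abs] at h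
    simp only [f]
    linarith

theorem sq_add_sq_le_of_isProj {p y z : X}
    (h : ∀ s ∈ Set.Icc (0 : ℝ) 1, dist p y ≤ dist p (g.geod y z s)) :
    dist p y ^ 2 + dist y z ^ 2 ≤ dist p z ^ 2 := by
  refine sub_nonpos.1 (nonpos_of_forall_le_mul_half_pow (C := dist y z ^ 2) fun n => ?_)
  have hpos : (0 : ℝ) < (1 / 2) ^ n := by positivity
  have hmem : ((1 : ℝ) / 2) ^ n ∈ Set.Icc (0 : ℝ) 1 :=
    ⟨hpos.le, pow_le_one₀ (by norm_num) (by norm_num)⟩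
  have h1 := pow_le_pow_left₀ dist_nonneg (h _ hmem) 2
  have h2 := g.dist_geod_sq_le p y z hmem
  refine le_of_mul_le_mul_left ?_ hpos
  linarith

theorem dist_geod_geod_le {p y z : X} (h : dist p y ^ 2 + dist y z ^ 2 ≤ dist p z ^ 2)
    {t : ℝ} (ht : 0 ≤ t) (hty : t ≤ dist p y) (htz : t ≤ dist p z) :
    dist (g.geod p y (t / dist p y)) (g.geod p z (t / dist p z)) ≤ √2 * t := by
  rcases ht.eq_or_lt with rfl | hpos
  · simp [g.geod_zero]
  have ha : 0 < dist p y := hpos.trans_le hty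
  have hb : 0 < dist p z := hpos.trans_le htz
  have hs : t / dist p y ∈ Set.Icc (0 : ℝ) 1 := ⟨by positivity, (div_le_one ha).2 hty⟩
  have hu : t / dist p z ∈ Set.Icc (0 : ℝ) 1 := ⟨by positivity, (div_le_one hb).2 htz⟩
  have hsa : t / dist p y * dist p y = t := div_mul_cancel₀ t ha.ne'
  have hub : t / dist p z * dist p z = t := div_mul_cancel₀ t hb.ne'
  generalize t / dist p y = s at *
  generalize t / dist p z = u at *
  have h1 := g.dist_geod_sq_le (g.geod p y s) p z hu
  have h2 := g.dist_geod_sq_le z p y hs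
  rw [dist_comm _ p, g.dist_left_geod p y hs, hsa, dist_comm _ z] at h1
  rw [dist_comm z p, dist_comm z y] at h2
  have h3 : dist z (g.geod p y s) ^ 2 ≤ dist p z ^ 2 - 2 * t * dist p y + t ^ 2 := by
    have := mul_le_mul_of_nonneg_left h hs.1
    rw [← hsa]
    linarith
  have h4 := mul_le_mul_of_nonneg_left h3 hu.1
  have h5 : 0 ≤ u * t * dist p y := mul_nonneg (mul_nonneg hu.1 ht) dist_nonneg
  have h6 : (u * dist p z) ^ 2 = t ^ 2 := by rw [hub]
  refine (pow_le_pow_iff_left₀ dist_nonneg (by positivity) two_ne_zero).1 ?_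
  rw [mul_pow, Real.sq_sqrt zero_le_two]
  linarith

end GeodCat

theorem pi_div_two_le_compAngle {X : Type*} [MetricSpace X] {x y z : X}
    (h : dist x y ^ 2 + dist x z ^ 2 ≤ dist y z ^ 2) : Real.pi / 2 ≤ compAngle x y z := by
  rw [compAngle, ← Real.arccos_zero]
  exact Real.arccos_le_arccos (div_nonpos_of_nonpos_of_nonneg (by linarith) (by positivity))

theorem compAngle_le_pi_div_two {X : Type*} [MetricSpace X] {x y z : X}
    (h : dist y z ^ 2 ≤ dist x y ^ 2 + dist x z ^ 2) : compAngle x y z ≤ Real.pi / 2 :=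
  Real.arccos_le_pi_div_two.2 (div_nonneg (by linarith) (by positivity))

open Filter Topology in
/-- The nested intersection property: a sequence with `dist p (x i)` bounded and satisfying the
obtuse-angle inequality converges. -/
theorem exists_tendsto_of_sq_add_sq_le {X : Type*} [MetricSpace X] [CompleteSpace X] {p : X}
    {x : ℕ → X}
    (h : ∀ i j, i ≤ j → dist p (x i) ^ 2 + dist (x i) (x j) ^ 2 ≤ dist p (x j) ^ 2)
    {C : ℝ} (hC : ∀ i, dist p (x i) ≤ C) : ∃ a, Tendsto x atTop (𝓝 a) := by
  have hm : Monotone fun i => dist p (x i) ^ 2 := fun i j hij => by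
    linarith [h i j hij, sq_nonneg (dist (x i) (x j))]
  have hb : BddAbove (Set.range fun i => dist p (x i) ^ 2) :=
    ⟨C ^ 2, by rintro _ ⟨i, rfl⟩; exact pow_le_pow_left₀ dist_nonneg (hC i) 2⟩
  have hcs := (tendsto_atTop_ciSup hm hb).cauchySeq
  refine cauchySeq_tendsto_of_complete (Metric.cauchySeq_iff'.2 fun ε hε => ?_)
  obtain ⟨N, hN⟩ := Metric.cauchySeq_iff'.1 hcs (ε ^ 2) (by positivity)
  refine ⟨N, fun n hn => lt_of_pow_lt_pow_left₀ 2 hε.le ?_⟩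
  have h1 := (le_abs_self _).trans_lt (hN n hn)
  rw [dist_comm]
  linarith [h N n hn]

/-- Let `X` be a complete CAT(0) space, `p ∈ X`, and `(A i)` a nested
non-increasing sequence of non-empty closed convex subsets with empty
intersection; let `x i` be the projection of `p` on `A i`. Then
`dist p (x i) → ∞`; for `i ≤ j` the comparison angle `∠̄_{x i}(p, x j) ≥ π/2`,
hence `∠̄_p(x i, x j) ≤ π/2`; and the points at distance `t` from `p` on the
segments `[p, x i]`, `[p, x j]` are at distance at most `√2 · t`. -/
theorem stmt18 {X : Type*} [MetricSpace X] [CompleteSpace X] (g : GeodCat X)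
    (p : X) (A : ℕ → Set X)
    (hne : ∀ i, (A i).Nonempty)
    (hcl : ∀ i, IsClosed (A i))
    (hconv : ∀ i, ∀ y ∈ A i, ∀ z ∈ A i, ∀ t ∈ Set.Icc (0 : ℝ) 1,
      g.geod y z t ∈ A i)
    (hmono : ∀ i, A (i + 1) ⊆ A i)
    (hempty : (⋂ i, A i) = ∅)
    (x : ℕ → X)
    (hx : ∀ i, x i ∈ A i ∧ ∀ z ∈ A i, dist p (x i) ≤ dist p z) :
    Filter.Tendsto (fun i => dist p (x i)) Filter.atTop Filter.atTop ∧
    (∀ i j, i ≤ j → Real.pi / 2 ≤ compAngle (x i) p (x j)) ∧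
    (∀ i j, i ≤ j → compAngle p (x i) (x j) ≤ Real.pi / 2) ∧
    (∀ i j, i ≤ j → ∀ t : ℝ, 0 ≤ t → t ≤ dist p (x i) → t ≤ dist p (x j) →
      dist (g.geod p (x i) (t / dist p (x i))) (g.geod p (x j) (t / dist p (x j)))
        ≤ Real.sqrt 2 * t) := by
  have hanti : Antitone A := antitone_nat_of_succ_le hmono
  have key : ∀ i j, i ≤ j → dist p (x i) ^ 2 + dist (x i) (x j) ^ 2 ≤ dist p (x j) ^ 2 :=
    fun i j hij => g.sq_add_sq_le_of_isProj fun s hs =>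
      (hx i).2 _ (hconv i _ (hx i).1 _ (hanti hij (hx j).1) s hs)
  refine ⟨?_, fun i j hij => ?_, fun i j hij => ?_, fun i j hij t ht hti htj =>
    g.dist_geod_geod_le (key i j hij) ht hti htj⟩
  · have hm : Monotone fun i => dist p (x i) := fun i j hij =>
      (hx i).2 _ (hanti hij (hx j).1)
    refine Filter.tendsto_atTop_atTop_of_monotone hm fun C => ?_
    by_contra! hC
    obtain ⟨a, ha⟩ := exists_tendsto_of_sq_add_sq_le key fun i => (hC i).le
    have hmem : a ∈ ⋂ i, A i := Set.mem_iInter.2 fun i =>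
      (hcl i).mem_of_tendsto ha <| Filter.eventually_atTop.2
        ⟨i, fun j hij => hanti hij (hx j).1⟩
    simp [hempty] at hmem
  · apply pi_div_two_le_compAngle
    rw [dist_comm (x i) p]
    exact key i j hij
  · apply compAngle_le_pi_div_two
    linarith [key i j hij, sq_nonneg (dist p (x i))]
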